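/- arXiv:1205.5132 — 10 statements merged into one kernel-verified Lean document; each statement's English description precedes it below -/
import Mathlib

section
/- Let d and N be positive natural numbers, let ρ be a d×d complex matrix that is positive semidefinite, and let A : Fin N → Matrix (Fin d) (Fin d) ℂ be any family of complex matrices. Define the extended family 𝒜 : Fin (N+1) → Matrix (Fin d) (Fin d) ℂ by 𝒜 0 = 1 (the identity matrix) and 𝒜 (a+1) = A a. Then the (N+1)×(N+1) complex matrix Ω with entries Ω a b = trace (ρ * 𝒜 a * (𝒜 b)ᴴ) is positive semidefinite. -/
open Matrix ComplexOrder

open scoped MatrixOrder Matrix.Norms.L2Operator in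
/-- For a positive semidefinite `ρ` and any family `B` of matrices, the Gram matrix with entries
`Tr (ρ B_a B_bᴴ)` is positive semidefinite. -/
lemma Matrix.PosSemidef.of_trace_mul_mul_conjTranspose {n m ι : Type*} [Fintype n] [Fintype m]
    [Finite ι] {ρ : Matrix n n ℂ} (hρ : ρ.PosSemidef) (B : ι → Matrix n m ℂ) :
    (Matrix.of fun a b => (ρ * B a * (B b)ᴴ).trace).PosSemidef := by
  classical
  have := Fintype.ofFinite ι
  obtain ⟨S, rfl⟩ := CStarAlgebra.nonneg_iff_eq_star_mul_self.mp hρ.nonneg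
  let X : Matrix ι (n × m) ℂ := Matrix.of fun a p => (S * B a) p.1 p.2
  convert Matrix.posSemidef_self_mul_conjTranspose X using 1
  ext a b
  rw [Matrix.star_eq_conjTranspose]
  have h : (Sᴴ * S * B a * (B b)ᴴ).trace = ((S * B a) * (S * B b)ᴴ).trace := by
    rw [Matrix.conjTranspose_mul, Matrix.mul_assoc, Matrix.mul_assoc, Matrix.trace_mul_comm]
    simp only [Matrix.mul_assoc]
  rw [Matrix.of_apply, h]
  simp only [X, Matrix.trace, Matrix.diag_apply, Matrix.mul_apply (M := S * B a),
    Matrix.mul_apply (M := Matrix.of _), Matrix.conjTranspose_apply, Matrix.of_apply,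
    Fintype.sum_prod_type]

/-- Theorem 1 of the paper: positivity of the density matrix `ρ` imputes positivity
to the matrix `Ω` of expectation values `Tr (ρ 𝒜_a 𝒜_b†)`, for every choice of the
extended family `𝒜 = (1, A₁, …, A_N)`. -/
theorem omega_posSemidef (d N : ℕ) (hd : 0 < d) (hN : 0 < N)
    (ρ : Matrix (Fin d) (Fin d) ℂ) (hρ : ρ.PosSemidef)
    (A : Fin N → Matrix (Fin d) (Fin d) ℂ)
    (𝒜 : Fin (N + 1) → Matrix (Fin d) (Fin d) ℂ)
    (h𝒜0 : 𝒜 0 = 1) (h𝒜succ : ∀ a : Fin N, 𝒜 a.succ = A a) :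
    (Matrix.of fun (a b : Fin (N + 1)) => (ρ * 𝒜 a * (𝒜 b)ᴴ).trace).PosSemidef := by
  exact hρ.of_trace_mul_mul_conjTranspose 𝒜
end

section
/- Let d and N be positive natural numbers, let ρ be a d×d complex positive semidefinite matrix with trace ρ = 1, and let A : Fin N → Matrix (Fin d) (Fin d) ℂ be a family of Hermitian matrices (each A a satisfies (A a)ᴴ = A a). For each a let m a = trace (ρ * A a) (which is a real scalar) and set ΔA a = A a - (m a) • 1. Then the N×N complex matrix Ω̃ with entries Ω̃ a b = trace (ρ * ΔA a * ΔA b) is positive semidefinite. -/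
open Matrix ComplexOrder

/-- The Gram matrix of a family of matrices with respect to the sesquilinear form
`(X, Y) ↦ Tr (ρ Xᴴ Y)` attached to a positive semidefinite matrix `ρ`. -/
theorem Matrix.PosSemidef.of_trace_mul_conjTranspose_mul {ι m n : Type*} [Fintype ι] [Fintype m]
    [Fintype n] {ρ : Matrix n n ℂ} (hρ : ρ.PosSemidef) (B : ι → Matrix m n ℂ) :
    (Matrix.of fun a b => (ρ * (B a)ᴴ * B b).trace).PosSemidef := by
  refine .of_dotProduct_mulVec_nonneg ?_ fun c => ?_
  · ext a b
    simp only [conjTranspose_apply, of_apply]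
    rw [← trace_conjTranspose]
    simp only [conjTranspose_mul, conjTranspose_conjTranspose, hρ.isHermitian.eq]
    rw [← Matrix.mul_assoc, trace_mul_comm, Matrix.mul_assoc]
  · have h := (hρ.mul_mul_conjTranspose_same (∑ a, c a • B a)).trace_nonneg
    rw [Matrix.mul_assoc, trace_mul_comm] at h
    convert h using 1
    simp only [conjTranspose_sum, conjTranspose_smul, Matrix.mul_sum, Matrix.sum_mul, trace_sum,
      dotProduct, mulVec, of_apply, Finset.mul_sum, Matrix.mul_smul, Matrix.smul_mul, trace_smul,
      smul_eq_mul, Pi.star_apply]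
    rw [Finset.sum_comm]
    exact Finset.sum_congr rfl fun _ _ => Finset.sum_congr rfl fun _ _ => by ring

/-- The expectation value of a Hermitian observable in a Hermitian state is real. -/
theorem Matrix.IsHermitian.star_trace_mul {n : Type*} [Fintype n] {ρ A : Matrix n n ℂ}
    (hρ : ρ.IsHermitian) (hA : A.IsHermitian) : star (ρ * A).trace = (ρ * A).trace := by
  rw [← trace_conjTranspose, conjTranspose_mul, hρ.eq, hA.eq, trace_mul_comm]

/-- Theorem 2 of the paper: for a density matrix `ρ` and Hermitian observables `A a`,
the matrix of expectation values of products of deviations from the means,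
`Ω̃ a b = Tr (ρ ΔA_a ΔA_b)` with `ΔA_a = A_a - ⟨A_a⟩ 1`, is positive semidefinite. -/
theorem omegaTilde_posSemidef (d N : ℕ) (hd : 0 < d) (hN : 0 < N)
    (ρ : Matrix (Fin d) (Fin d) ℂ) (hρ : ρ.PosSemidef) (htr : ρ.trace = 1)
    (A : Fin N → Matrix (Fin d) (Fin d) ℂ) (hA : ∀ a, (A a)ᴴ = A a)
    (ΔA : Fin N → Matrix (Fin d) (Fin d) ℂ)
    (hΔA : ∀ a, ΔA a = A a - (ρ * A a).trace • (1 : Matrix (Fin d) (Fin d) ℂ)) :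
    (Matrix.of fun (a b : Fin N) => (ρ * ΔA a * ΔA b).trace).PosSemidef := by
  have hΔ : ∀ a, (ΔA a)ᴴ = ΔA a := fun a => by
    rw [hΔA, conjTranspose_sub, conjTranspose_smul, conjTranspose_one, hA,
      hρ.isHermitian.star_trace_mul (hA a)]
  simpa only [hΔ] using hρ.of_trace_mul_conjTranspose_mul ΔA
end

section
/- Let Q be an N×N complex Hermitian positive semidefinite matrix, and write Q = R.map (↑) + Complex.I • S.map (↑), where R is a real symmetric N×N matrix and S is a real antisymmetric N×N matrix (so R a b = re (Q a b) and S a b = im (Q a b)). If det S ≠ 0, then R is positive definite. -/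
open Matrix ComplexOrder

/-- Lemma 2 of the paper: if a Hermitian positive semidefinite matrix
`Q = R + i S` (with `R` real symmetric and `S` real antisymmetric) has
nonsingular antisymmetric part `S`, then its real part `R` is positive definite. -/
theorem real_part_posDef_of_posSemidef {N : ℕ}
    (Q : Matrix (Fin N) (Fin N) ℂ) (hQ : Q.PosSemidef)
    (R S : Matrix (Fin N) (Fin N) ℝ)
    (hR : Rᵀ = R) (hS : Sᵀ = -S)
    (hQRS : Q = R.map (fun x => (x : ℂ)) + Complex.I • S.map (fun x => (x : ℂ)))
    (hdet : S.det ≠ 0) :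
    R.PosDef := by
  subst hQRS
  have hmul (x : Fin N → ℝ) (i : Fin N) :
      ((R.map (fun x => (x : ℂ)) + Complex.I • S.map (fun x => (x : ℂ))) *ᵥ
        (fun j => (x j : ℂ))) i = ((R *ᵥ x) i : ℂ) + Complex.I * ((S *ᵥ x) i : ℂ) := by
    simp [mulVec, dotProduct, add_mul, Finset.sum_add_distrib, Finset.mul_sum, mul_assoc]
  have hskew (x : Fin N → ℝ) : x ⬝ᵥ S *ᵥ x = 0 := by
    have h : x ⬝ᵥ S *ᵥ x = -(x ⬝ᵥ S *ᵥ x) := by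
      conv_lhs => rw [dotProduct_mulVec, ← mulVec_transpose, hS, neg_mulVec, neg_dotProduct,
        dotProduct_comm]
    linarith
  have hform (x : Fin N → ℝ) :
      star (fun j => (x j : ℂ)) ⬝ᵥ
        ((R.map (fun x => (x : ℂ)) + Complex.I • S.map (fun x => (x : ℂ))) *ᵥ
          (fun j => (x j : ℂ))) = ((x ⬝ᵥ R *ᵥ x : ℝ) : ℂ) := by
    have h : ((x ⬝ᵥ R *ᵥ x : ℝ) : ℂ) =
        ((x ⬝ᵥ R *ᵥ x : ℝ) : ℂ) + Complex.I * ((x ⬝ᵥ S *ᵥ x : ℝ) : ℂ) := by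
      rw [hskew]; simp
    rw [h]
    simp only [dotProduct, hmul, Pi.star_apply, RCLike.star_def, Complex.conj_ofReal,
      Complex.ofReal_sum, Complex.ofReal_mul, Finset.mul_sum, ← Finset.sum_add_distrib]
    exact Finset.sum_congr rfl fun i _ => by ring
  refine PosDef.of_dotProduct_mulVec_pos ?_ fun x hx => ?_
  · rwa [IsHermitian, conjTranspose_eq_transpose_of_trivial]
  rw [star_trivial]
  refine lt_of_le_of_ne ?_ fun h0 => hx ?_
  · have h := hQ.dotProduct_mulVec_nonneg (fun j => (x j : ℂ))
    rw [hform] at h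
    exact_mod_cast h
  · have hker := (hQ.dotProduct_mulVec_zero_iff (fun j => (x j : ℂ))).mp (by
      rw [hform, ← h0, Complex.ofReal_zero])
    refine eq_zero_of_mulVec_eq_zero hdet (funext fun i => ?_)
    have hi := congrArg Complex.im (congrFun hker i)
    rw [hmul] at hi
    simpa using hi
end

section
/- Let d and N be positive natural numbers, let ρ be a d×d complex positive semidefinite matrix with trace 1, and let A : Fin N → Matrix (Fin d) (Fin d) ℂ be a family of Hermitian matrices. For each a set m a = trace (ρ * A a) and ΔA a = A a - (m a) • 1, and define real matrices V and ω by V a b = re (trace (ρ * (ΔA a * ΔA b + ΔA b * ΔA a)) / 2) and ω a b = re ((-Complex.I) * trace (ρ * (ΔA a * ΔA b - ΔA b * ΔA a))). Then: (i) trace (ρ * (ΔA a * ΔA b + ΔA b * ΔA a)) / 2 and (-Complex.I) * trace (ρ * (ΔA a * ΔA b - ΔA b * ΔA a)) are real (have zero imaginary part); (ii) V is symmetric and ω is antisymmetric; and (iii) the complex matrix V.map (↑) + (Complex.I / 2) • ω.map (↑) is positive semidefinite. -/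
open Matrix ComplexOrder

/-- The Gram matrix of a family of matrices with respect to the (semi-)inner product
`⟨X, Y⟩ = trace (ρ Xᴴ Y)` given by a positive semidefinite matrix `ρ`. -/
theorem posSemidef_gram_trace {n ι : Type*} [Fintype n] [Fintype ι]
    {ρ : Matrix n n ℂ} (hρ : ρ.PosSemidef) (B : ι → Matrix n n ℂ) :
    (Matrix.of fun a b => (ρ * ((B a)ᴴ * B b)).trace).PosSemidef := by
  refine .of_dotProduct_mulVec_nonneg ?_ fun x => ?_
  · ext a b
    rw [conjTranspose_apply, of_apply, of_apply, ← trace_conjTranspose]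
    simp only [conjTranspose_mul, conjTranspose_conjTranspose, hρ.isHermitian.eq]
    rw [trace_mul_comm]
  · have h := (hρ.mul_mul_conjTranspose_same (∑ b, x b • B b)).trace_nonneg
    rw [mul_assoc, trace_mul_comm, mul_assoc] at h
    convert h using 1
    simp only [dotProduct, mulVec, of_apply, Pi.star_apply, conjTranspose_sum,
      conjTranspose_smul, Finset.sum_mul, Finset.mul_sum, trace_sum, smul_mul_assoc,
      mul_smul_comm, trace_smul, smul_eq_mul]
    rw [Finset.sum_comm]
    refine Finset.sum_congr rfl fun a _ => Finset.sum_congr rfl fun b _ => ?_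
    ring

/-- The expectation value of a Hermitian matrix is self-adjoint. -/
theorem star_trace_mul_of_isHermitian {n : Type*} [Fintype n] {ρ X : Matrix n n ℂ}
    (hρ : ρ.IsHermitian) (hX : X.IsHermitian) : star (ρ * X).trace = (ρ * X).trace := by
  rw [← trace_conjTranspose, conjTranspose_mul, hρ.eq, hX.eq, trace_mul_comm]

/-- The general uncertainty relation (2.19) of the paper: for a density matrix `ρ` and
Hermitian observables `A a` with deviations `ΔA a = A a - ⟨A a⟩ 1`, the anticommutator
and (rescaled) commutator expectation values are real, the variance matrix `V` is
symmetric, the commutator correction matrix `ω` is antisymmetric, and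
`V + (i/2) ω ≥ 0`. -/
theorem general_uncertainty_relation (d N : ℕ) (hd : 0 < d) (hN : 0 < N)
    (ρ : Matrix (Fin d) (Fin d) ℂ) (hρ : ρ.PosSemidef) (htr : ρ.trace = 1)
    (A : Fin N → Matrix (Fin d) (Fin d) ℂ) (hA : ∀ a, (A a)ᴴ = A a)
    (ΔA : Fin N → Matrix (Fin d) (Fin d) ℂ)
    (hΔA : ∀ a, ΔA a = A a - (ρ * A a).trace • (1 : Matrix (Fin d) (Fin d) ℂ))
    (V ω : Matrix (Fin N) (Fin N) ℝ)
    (hV : ∀ a b, V a b = ((ρ * (ΔA a * ΔA b + ΔA b * ΔA a)).trace / 2).re)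
    (hω : ∀ a b, ω a b = ((-Complex.I) * (ρ * (ΔA a * ΔA b - ΔA b * ΔA a)).trace).re) :
    (∀ a b, ((ρ * (ΔA a * ΔA b + ΔA b * ΔA a)).trace / 2).im = 0 ∧
        ((-Complex.I) * (ρ * (ΔA a * ΔA b - ΔA b * ΔA a)).trace).im = 0) ∧
      (Vᵀ = V ∧ ωᵀ = -ω) ∧
      (V.map (fun x => (x : ℂ)) +
        (Complex.I / 2) • ω.map (fun x => (x : ℂ))).PosSemidef := by
  have hΔ : ∀ a, (ΔA a)ᴴ = ΔA a := fun a => by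
    rw [hΔA, conjTranspose_sub, conjTranspose_smul, hA, conjTranspose_one,
      star_trace_mul_of_isHermitian hρ.isHermitian (hA a)]
  have hG := posSemidef_gram_trace hρ ΔA
  simp only [hΔ] at hG
  set G : Matrix (Fin N) (Fin N) ℂ := Matrix.of fun a b => (ρ * (ΔA a * ΔA b)).trace
  have hGs : ∀ a b, (ρ * (ΔA a * ΔA b)).trace = G a b := fun _ _ => rfl
  have hre : ∀ a b, (G b a).re = (G a b).re := fun a b => by
    simpa using congrArg Complex.re (hG.isHermitian.apply a b)
  have him : ∀ a b, (G b a).im = -(G a b).im := fun a b => by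
    rw [← hG.isHermitian.apply a b]
    simp
  simp only [mul_add, mul_sub, trace_add, trace_sub, hGs] at hV hω ⊢
  have hV' : ∀ a b, V a b = (G a b).re := fun a b => by
    simp [hV, hre a b]
  have hω' : ∀ a b, ω a b = 2 * (G a b).im := fun a b => by
    simp [hω, him a b]
    ring
  refine ⟨fun a b => ⟨by simp [him a b], by simp [hre a b]⟩, ⟨?_, ?_⟩, ?_⟩
  · ext a b
    simp [hV', hre a b]
  · ext a b
    simp [hω', him a b]
  · convert hG using 1
    ext a b
    apply Complex.ext <;> simp [hV', hω']
end

section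
/- Fix n ≥ 1 and ℏ > 0, and let β be the 2n×2n real block-diagonal matrix consisting of n copies of the 2×2 block [[0,1],[-1,0]] along the diagonal. Let V be a real symmetric 2n×2n matrix such that the complex matrix V.map (↑) + (Complex.I * ℏ / 2) • β.map (↑) is positive semidefinite. Then V is positive definite (xᵀ V x > 0 for every nonzero real vector x). -/
open Matrix ComplexOrder

/-- If `V + i c B` is positive semidefinite with `V`, `B`, `c` real, `V` symmetric, `c ≠ 0` and
`B` injective, then `V` is positive definite. -/
theorem posDef_of_posSemidef_add_I_smul {m : Type*} [Fintype m] {V B : Matrix m m ℝ} {c : ℝ}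
    (hV : Vᵀ = V) (hc : c ≠ 0) (hB : ∀ x, B *ᵥ x = 0 → x = 0)
    (h : (V.map (fun x => (x : ℂ)) +
      (Complex.I * c) • B.map (fun x => (x : ℂ))).PosSemidef) :
    V.PosDef := by
  refine .of_dotProduct_mulVec_pos (by rw [IsHermitian, conjTranspose_eq_transpose_of_trivial, hV])
    fun x hx => ?_
  set z : m → ℂ := fun i => (x i : ℂ) with hz
  have hmap (A : Matrix m m ℝ) :
      A.map (fun x => (x : ℂ)) *ᵥ z = fun i => ((A *ᵥ x) i : ℂ) := by
    ext i
    simp [mulVec, dotProduct, hz]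
  have hdot (y : m → ℝ) : star z ⬝ᵥ (fun i => (y i : ℂ)) = ((x ⬝ᵥ y : ℝ) : ℂ) := by
    simp [dotProduct, hz]
  have hform : star z ⬝ᵥ ((V.map (fun x => (x : ℂ)) +
      (Complex.I * c) • B.map (fun x => (x : ℂ))) *ᵥ z) =
      ((x ⬝ᵥ V *ᵥ x : ℝ) : ℂ) + Complex.I * c * ((x ⬝ᵥ B *ᵥ x : ℝ) : ℂ) := by
    rw [add_mulVec, smul_mulVec, dotProduct_add, dotProduct_smul, hmap, hmap, hdot, hdot,
      smul_eq_mul]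
  have hnonneg := h.dotProduct_mulVec_nonneg z
  rw [hform, Complex.le_def] at hnonneg
  obtain ⟨hre, him⟩ := hnonneg
  simp only [Complex.zero_re, Complex.zero_im, Complex.add_re, Complex.add_im, Complex.mul_re,
    Complex.mul_im, Complex.I_re, Complex.I_im, Complex.ofReal_re, Complex.ofReal_im, zero_mul,
    mul_zero, one_mul, sub_zero, add_zero, zero_add] at hre him
  rw [star_trivial]
  refine lt_of_le_of_ne hre fun h0 => hx (hB x ?_)
  have hker := (h.dotProduct_mulVec_zero_iff z).1 (by
    rw [hform, ← h0, mul_assoc, ← Complex.ofReal_mul, ← him]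
    simp)
  rw [add_mulVec, smul_mulVec, hmap, hmap] at hker
  ext i
  have him_i := congrArg Complex.im (congrFun hker i)
  simpa [hc] using him_i

/-- The standard symplectic metric of an `n`-mode system has trivial kernel. -/
theorem eq_zero_of_symplecticMetric_mulVec_eq_zero {n : ℕ}
    {β : Matrix (Fin (2 * n)) (Fin (2 * n)) ℝ}
    (hβ : ∀ i j : Fin (2 * n), β i j =
      if (i : ℕ) / 2 = (j : ℕ) / 2 then
        (if (i : ℕ) % 2 = 0 ∧ (j : ℕ) % 2 = 1 then 1
          else if (i : ℕ) % 2 = 1 ∧ (j : ℕ) % 2 = 0 then -1 else 0)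
      else 0)
    (x : Fin (2 * n) → ℝ) (hx : β *ᵥ x = 0) : x = 0 := by
  ext i
  obtain ⟨j, hdiv, hmod⟩ : ∃ j : Fin (2 * n), (j : ℕ) / 2 = (i : ℕ) / 2 ∧
      (j : ℕ) % 2 ≠ (i : ℕ) % 2 :=
    ⟨⟨2 * ((i : ℕ) / 2) + (1 - (i : ℕ) % 2), by omega⟩, by dsimp only; omega,
      by dsimp only; omega⟩
  have hother (k : Fin (2 * n)) (hk : k ≠ i) : β j k = 0 := by
    have hne : (k : ℕ) ≠ i := Fin.val_ne_of_ne hk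
    rw [hβ]
    split_ifs <;> first | rfl | omega
  have hji : β j i ≠ 0 := by
    rw [hβ]
    split_ifs <;> first | omega | norm_num
  have hj : ∑ k, β j k * x k = 0 := congrFun hx j
  rw [Finset.sum_eq_single i (fun k _ hk => by rw [hother k hk, zero_mul]) (by simp)] at hj
  exact (mul_eq_zero.1 hj).resolve_left hji

/-- The parenthetical consequence of the n-mode Schrödinger–Robertson uncertainty
principle (3.5) of the paper: since the symplectic metric `β` (block diagonal with
`n` copies of `[[0,1],[-1,0]]`) is nonsingular, `V + (iℏ/2) β ≥ 0` forces the
variance matrix `V` to be positive definite. -/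
theorem variance_posDef_of_SR (n : ℕ) (hn : 1 ≤ n) (ℏ : ℝ) (hℏ : 0 < ℏ)
    (β : Matrix (Fin (2 * n)) (Fin (2 * n)) ℝ)
    (hβ : ∀ i j : Fin (2 * n), β i j =
      if (i : ℕ) / 2 = (j : ℕ) / 2 then
        (if (i : ℕ) % 2 = 0 ∧ (j : ℕ) % 2 = 1 then 1
          else if (i : ℕ) % 2 = 1 ∧ (j : ℕ) % 2 = 0 then -1 else 0)
      else 0)
    (V : Matrix (Fin (2 * n)) (Fin (2 * n)) ℝ) (hV : Vᵀ = V)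
    (hSR : (V.map (fun x => (x : ℂ)) +
      (Complex.I * ℏ / 2) • β.map (fun x => (x : ℂ))).PosSemidef) :
    V.PosDef := by
  refine posDef_of_posSemidef_add_I_smul (c := ℏ / 2) hV (by positivity)
    (eq_zero_of_symplecticMetric_mulVec_eq_zero hβ) ?_
  rwa [Complex.ofReal_div, Complex.ofReal_ofNat, ← mul_div_assoc]
end

section
/- Fix ℏ > 0 and let β = [[0,1],[-1,0]] (a 2×2 real matrix). For every real symmetric 2×2 matrix V, the complex matrix V.map (↑) + (Complex.I * ℏ / 2) • β.map (↑) is positive semidefinite if and only if V is positive semidefinite (as a real symmetric matrix) and det V ≥ ℏ²/4. -/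
open Matrix ComplexOrder

/-- A Hermitian `2 × 2` matrix is positive semidefinite iff its trace and determinant are
nonnegative. -/
theorem Matrix.IsHermitian.posSemidef_fin_two_iff {𝕜 : Type*} [RCLike 𝕜]
    {A : Matrix (Fin 2) (Fin 2) 𝕜} (hA : A.IsHermitian) :
    A.PosSemidef ↔ 0 ≤ A.trace ∧ 0 ≤ A.det := by
  refine ⟨fun h => ⟨h.trace_nonneg, h.det_nonneg⟩, fun ⟨htr, hdet⟩ => ?_⟩
  rw [hA.trace_eq_sum_eigenvalues, Fin.sum_univ_two] at htr
  rw [hA.det_eq_prod_eigenvalues, Fin.prod_univ_two] at hdet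
  norm_cast at htr hdet
  rw [hA.posSemidef_iff_eigenvalues_nonneg]
  intro i
  fin_cases i <;> simp <;> nlinarith

/-- The single-mode Schrödinger–Robertson uncertainty principle, Eq. (3.7) of the
paper: for a real symmetric `2 × 2` matrix `V` and `β = [[0,1],[-1,0]]`,
`V + (iℏ/2) β ≥ 0` iff `V ≥ 0` and `det V ≥ ℏ²/4`. -/
theorem single_mode_SR (ℏ : ℝ) (hℏ : 0 < ℏ)
    (V : Matrix (Fin 2) (Fin 2) ℝ) (hV : Vᵀ = V) :
    (V.map (fun x => (x : ℂ)) +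
        (Complex.I * ℏ / 2) • (!![0, 1; -1, 0] : Matrix (Fin 2) (Fin 2) ℝ).map
          (fun x => (x : ℂ))).PosSemidef ↔
      V.PosSemidef ∧ ℏ ^ 2 / 4 ≤ V.det := by
  have hsymm : V 1 0 = V 0 1 := congrFun (congrFun hV 0) 1
  set M : Matrix (Fin 2) (Fin 2) ℂ := V.map (fun x => (x : ℂ)) +
    (Complex.I * ℏ / 2) • (!![0, 1; -1, 0] : Matrix (Fin 2) (Fin 2) ℝ).map
      (fun x => (x : ℂ)) with hM
  have hVherm : V.IsHermitian := by rwa [IsHermitian, conjTranspose_eq_transpose_of_trivial]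
  have hMherm : M.IsHermitian := by
    ext i j
    fin_cases i <;> fin_cases j <;> simp [hM, hsymm, neg_div]
  have htrace : M.trace = (V.trace : ℝ) := by
    simp [hM, trace_fin_two]
  have hdet : M.det = ((V.det - ℏ ^ 2 / 4 : ℝ) : ℂ) := by
    simp [hM, det_fin_two, hsymm]
    linear_combination (ℏ ^ 2 / 4 : ℂ) * Complex.I_sq
  rw [hMherm.posSemidef_fin_two_iff, hVherm.posSemidef_fin_two_iff, htrace, hdet,
    Complex.zero_le_real, Complex.zero_le_real, sub_nonneg]
  exact ⟨fun ⟨ht, hd⟩ => ⟨⟨ht, le_trans (by positivity) hd⟩, hd⟩, fun ⟨⟨ht, _⟩, hd⟩ => ⟨ht, hd⟩⟩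
end

section
/- Fix n ≥ 1 and ℏ > 0, let J denote the real 2n×2n matrix of the standard symplectic form used by Mathlib's symplectic group (so that S ∈ Matrix.symplecticGroup (Fin n) ℝ if and only if S * J * Sᵀ = J), and let V be a real symmetric 2n×2n matrix. Then for every S in the symplectic group, the complex matrix V.map (↑) + (Complex.I * ℏ / 2) • J.map (↑) is positive semidefinite if and only if the complex matrix (S * V * Sᵀ).map (↑) + (Complex.I * ℏ / 2) • J.map (↑) is positive semidefinite. -/
open Matrix ComplexOrder

/-- The Sp(2n,R) covariance (3.10) of the n-mode Schrödinger–Robertson uncertainty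
principle: for `S` in the symplectic group (so `S * J * Sᵀ = J` for the standard
symplectic form `J`), `V + (iℏ/2) J ≥ 0` iff `S V Sᵀ + (iℏ/2) J ≥ 0`. -/
theorem SR_symplectic_covariance (n : ℕ) (hn : 1 ≤ n) (ℏ : ℝ) (hℏ : 0 < ℏ)
    (V : Matrix (Fin n ⊕ Fin n) (Fin n ⊕ Fin n) ℝ) (hV : Vᵀ = V)
    (S : Matrix (Fin n ⊕ Fin n) (Fin n ⊕ Fin n) ℝ)
    (hS : S ∈ Matrix.symplecticGroup (Fin n) ℝ) :
    (V.map (fun x => (x : ℂ)) +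
        (Complex.I * ℏ / 2) • (Matrix.J (Fin n) ℝ).map (fun x => (x : ℂ))).PosSemidef ↔
      ((S * V * Sᵀ).map (fun x => (x : ℂ)) +
        (Complex.I * ℏ / 2) • (Matrix.J (Fin n) ℝ).map (fun x => (x : ℂ))).PosSemidef := by
  have hunit : IsUnit (S.map (algebraMap ℝ ℂ)) :=
    ((Matrix.isUnit_iff_isUnit_det S).2 (SymplecticGroup.symplectic_det hS)).map
      (algebraMap ℝ ℂ).mapMatrix
  have hstar : star (S.map (algebraMap ℝ ℂ)) = Sᵀ.map (algebraMap ℝ ℂ) := by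
    ext i j
    simp [star_apply]
  have hJ : (S.map (algebraMap ℝ ℂ)) * ((Matrix.J (Fin n) ℝ).map (algebraMap ℝ ℂ)) *
      (Sᵀ.map (algebraMap ℝ ℂ)) = (Matrix.J (Fin n) ℝ).map (algebraMap ℝ ℂ) := by
    rw [← Matrix.map_mul, ← Matrix.map_mul, SymplecticGroup.mem_iff.1 hS]
  change (V.map (algebraMap ℝ ℂ) +
      (Complex.I * ℏ / 2) • (Matrix.J (Fin n) ℝ).map (algebraMap ℝ ℂ)).PosSemidef ↔
    ((S * V * Sᵀ).map (algebraMap ℝ ℂ) +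
      (Complex.I * ℏ / 2) • (Matrix.J (Fin n) ℝ).map (algebraMap ℝ ℂ)).PosSemidef
  rw [← hunit.posSemidef_star_right_conjugate_iff, hstar, Matrix.mul_add, Matrix.add_mul,
    Matrix.mul_smul, Matrix.smul_mul, hJ, Matrix.map_mul, Matrix.map_mul]
end

section
/- Let ψ : 𝓢(ℝ, ℂ) be a Schwartz function with ∫ ‖ψ x‖² dx = 1 (unit L² norm), and let ψ' denote its derivative (also a Schwartz function). Define the real numbers q̄ = ∫ x * ‖ψ x‖² dx, p̄ = ∫ im (conj (ψ x) * ψ' x) dx, Vq = ∫ (x - q̄)² * ‖ψ x‖² dx, Vp = (∫ ‖ψ' x‖² dx) - p̄², and Cqp = (∫ x * im (conj (ψ x) * ψ' x) dx) - q̄ * p̄. Then Vq * Vp - Cqp² ≥ 1/4. -/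
open MeasureTheory

theorem SchwartzMap.integrable_pow_mul_conj_mul (f g : SchwartzMap ℝ ℂ) (k : ℕ) :
    Integrable fun x : ℝ => (x : ℂ) ^ k * ((starRingEnd ℂ) (f x) * g x) := by
  have hg : Integrable fun x : ℝ => (x : ℂ) ^ k * g x :=
    (g.integrable_pow_mul volume k).mono (by fun_prop) (.of_forall fun x => by simp)
  obtain ⟨C, -, hC⟩ := f.decay 0 0
  have h := hg.bdd_mul (f := fun x => (starRingEnd ℂ) (f x)) (c := C)
    (by fun_prop) (.of_forall fun x => by simpa using hC x)
  exact h.congr (.of_forall fun x => by ring)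

theorem SchwartzMap.integrable_pow_mul_re (f g : SchwartzMap ℝ ℂ) (k : ℕ) :
    Integrable fun x : ℝ => x ^ k * ((starRingEnd ℂ) (f x) * g x).re := by
  refine (f.integrable_pow_mul_conj_mul g k).re.congr (.of_forall fun x => ?_)
  change ((x : ℂ) ^ k * _).re = _
  rw [← Complex.ofReal_pow, Complex.re_ofReal_mul]

theorem SchwartzMap.integrable_pow_mul_im (f g : SchwartzMap ℝ ℂ) (k : ℕ) :
    Integrable fun x : ℝ => x ^ k * ((starRingEnd ℂ) (f x) * g x).im := by
  refine (f.integrable_pow_mul_conj_mul g k).im.congr (.of_forall fun x => ?_)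
  change ((x : ℂ) ^ k * _).im = _
  rw [← Complex.ofReal_pow, Complex.im_ofReal_mul]

theorem SchwartzMap.integrable_pow_mul_norm_sq (f : SchwartzMap ℝ ℂ) (k : ℕ) :
    Integrable fun x : ℝ => x ^ k * ‖f x‖ ^ 2 := by
  refine (f.integrable_pow_mul_re f k).congr (.of_forall fun x => ?_)
  dsimp only
  rw [← Complex.normSq_eq_conj_mul_self, Complex.normSq_eq_norm_sq, Complex.ofReal_re]

theorem SchwartzMap.integral_norm_sq_add_sub_mul_re_conj_mul_deriv (f : SchwartzMap ℝ ℂ) (q : ℝ) :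
    ∫ x : ℝ, (‖f x‖ ^ 2 + (x - q) * (2 * ((starRingEnd ℂ) (f x) * deriv f x).re)) = 0 := by
  have h0 := f.integrable_pow_mul_norm_sq 0
  have h1 := f.integrable_pow_mul_norm_sq 1
  have r0 := f.integrable_pow_mul_re (SchwartzMap.derivCLM ℂ ℂ f) 0
  have r1 := f.integrable_pow_mul_re (SchwartzMap.derivCLM ℂ ℂ f) 1
  simp only [SchwartzMap.derivCLM_apply] at r0 r1
  refine integral_eq_zero_of_hasDerivAt_of_integrable
    (f := fun x => (x - q) * ‖f x‖ ^ 2) (fun x => ?_) ?_ ?_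
  · refine (((hasDerivAt_id x).sub_const q).mul (f.hasDerivAt x).norm_sq).congr_deriv ?_
    simp only [Complex.inner, id, one_mul, mul_comm (deriv f x)]
  · exact (h0.add ((r1.const_mul 2).sub (r0.const_mul (2 * q)))).congr
      (.of_forall fun x => by simp only [Pi.add_apply, Pi.sub_apply]; ring)
  · exact (h1.sub (h0.const_mul q)).congr
      (.of_forall fun x => by simp only [Pi.sub_apply]; ring)

/-- Pointwise expansion of `‖w + (c (x - q) - i p) z‖²` with `c = a + i b` and `y = x - q`. -/
theorem Complex.norm_sq_add_mul_expand (z w : ℂ) (a b p y : ℝ) :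
    ‖w + (⟨a * y, b * y - p⟩ : ℂ) * z‖ ^ 2 =
      ‖w‖ ^ 2 + (a ^ 2 * y ^ 2 + (b * y - p) ^ 2) * ‖z‖ ^ 2
        + 2 * (a * y * ((starRingEnd ℂ) z * w).re + (b * y - p) * ((starRingEnd ℂ) z * w).im) := by
  simp only [← Complex.normSq_eq_norm_sq, Complex.normSq_apply, Complex.add_re, Complex.add_im,
    Complex.mul_re, Complex.mul_im, Complex.conj_re, Complex.conj_im]
  ring

/-- Robertson's inequality from nonnegativity of the associated quadratic form. -/
theorem quarter_le_mul_sub_sq_of_forall_nonneg {V W C : ℝ}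
    (h : ∀ a b : ℝ, 0 ≤ W + (a ^ 2 + b ^ 2) * V - a + 2 * b * C) : 1 / 4 ≤ V * W - C ^ 2 := by
  have hD : 0 < 1 / 4 + C ^ 2 := by positivity
  have hd := discrim_le_zero (a := (1 / 4 + C ^ 2) * V) (b := -2 * (1 / 4 + C ^ 2)) (c := W)
    fun s => by linarith [h (s / 2) (-C * s)]
  rw [discrim] at hd
  have : 1 / 4 + C ^ 2 ≤ V * W := le_of_mul_le_mul_left (by linarith) hD
  linarith

/-- The Schrödinger–Robertson uncertainty principle (ℏ = 1) for a pure state with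
normalised Schwartz wavefunction `ψ`: with `q̄, p̄` the position and momentum means,
`Vq, Vp` the variances and `Cqp` the covariance, one has `Vq Vp - Cqp² ≥ 1/4`. -/
theorem schrodinger_robertson_wavefunction (ψ ψ' : SchwartzMap ℝ ℂ)
    (hderiv : ∀ x : ℝ, ψ' x = deriv (fun t : ℝ => ψ t) x)
    (hnorm : ∫ x : ℝ, ‖ψ x‖ ^ 2 = 1)
    (qbar pbar Vq Vp Cqp : ℝ)
    (hq : qbar = ∫ x : ℝ, x * ‖ψ x‖ ^ 2)
    (hp : pbar = ∫ x : ℝ, ((starRingEnd ℂ) (ψ x) * ψ' x).im)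
    (hVq : Vq = ∫ x : ℝ, (x - qbar) ^ 2 * ‖ψ x‖ ^ 2)
    (hVp : Vp = (∫ x : ℝ, ‖ψ' x‖ ^ 2) - pbar ^ 2)
    (hCqp : Cqp = (∫ x : ℝ, x * ((starRingEnd ℂ) (ψ x) * ψ' x).im) - qbar * pbar) :
    Vq * Vp - Cqp ^ 2 ≥ 1 / 4 := by
  have hd : ∀ x, deriv ψ x = ψ' x := fun x => (hderiv x).symm
  have n0 := ψ.integrable_pow_mul_norm_sq 0
  have n1 := ψ.integrable_pow_mul_norm_sq 1
  have n2 := ψ.integrable_pow_mul_norm_sq 2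
  have k0 := ψ'.integrable_pow_mul_norm_sq 0
  have r0 := ψ.integrable_pow_mul_re ψ' 0
  have r1 := ψ.integrable_pow_mul_re ψ' 1
  have i0 := ψ.integrable_pow_mul_im ψ' 0
  have i1 := ψ.integrable_pow_mul_im ψ' 1
  have hparts := ψ.integral_norm_sq_add_sub_mul_re_conj_mul_deriv qbar
  simp only [hd] at hparts
  simp only [pow_zero, pow_one, one_mul] at n0 n1 k0 r0 r1 i0 i1
  have ny : Integrable fun x : ℝ => (x - qbar) * ‖ψ x‖ ^ 2 :=
    (n1.sub (n0.const_mul qbar)).congr (.of_forall fun x => by simp only [Pi.sub_apply]; ring)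
  have nyy : Integrable fun x : ℝ => (x - qbar) ^ 2 * ‖ψ x‖ ^ 2 :=
    (n2.sub ((n1.const_mul (2 * qbar)).sub (n0.const_mul (qbar ^ 2)))).congr
      (.of_forall fun x => by simp only [Pi.sub_apply]; ring)
  have ry : Integrable fun x : ℝ => (x - qbar) * ((starRingEnd ℂ) (ψ x) * ψ' x).re :=
    (r1.sub (r0.const_mul qbar)).congr (.of_forall fun x => by simp only [Pi.sub_apply]; ring)
  have iy : Integrable fun x : ℝ => (x - qbar) * ((starRingEnd ℂ) (ψ x) * ψ' x).im :=
    (i1.sub (i0.const_mul qbar)).congr (.of_forall fun x => by simp only [Pi.sub_apply]; ring)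
  have Iny : ∫ x : ℝ, (x - qbar) * ‖ψ x‖ ^ 2 = 0 := by
    simp only [sub_mul]
    rw [integral_sub n1 (n0.const_mul _), integral_const_mul, hnorm, ← hq]
    ring
  have Iiy : ∫ x : ℝ, (x - qbar) * ((starRingEnd ℂ) (ψ x) * ψ' x).im = Cqp := by
    simp only [sub_mul]
    rw [integral_sub i1 (i0.const_mul _), integral_const_mul, ← hp, hCqp]
  have Iry : ∫ x : ℝ, (x - qbar) * ((starRingEnd ℂ) (ψ x) * ψ' x).re = -1 / 2 := by
    simp only [mul_left_comm _ (2 : ℝ)] at hparts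
    rw [integral_add n0 (ry.const_mul 2), integral_const_mul, hnorm] at hparts
    linarith
  refine quarter_le_mul_sub_sq_of_forall_nonneg fun a b => ?_
  have hpos : 0 ≤ ∫ x : ℝ, ‖ψ' x + (⟨a * (x - qbar), b * (x - qbar) - pbar⟩ : ℂ) * ψ x‖ ^ 2 :=
    integral_nonneg fun x => by positivity
  have hexp : ∀ x : ℝ, ‖ψ' x + (⟨a * (x - qbar), b * (x - qbar) - pbar⟩ : ℂ) * ψ x‖ ^ 2 =
      ‖ψ' x‖ ^ 2 + (a ^ 2 + b ^ 2) * ((x - qbar) ^ 2 * ‖ψ x‖ ^ 2)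
        + -2 * b * pbar * ((x - qbar) * ‖ψ x‖ ^ 2) + pbar ^ 2 * ‖ψ x‖ ^ 2
        + 2 * a * ((x - qbar) * ((starRingEnd ℂ) (ψ x) * ψ' x).re)
        + 2 * b * ((x - qbar) * ((starRingEnd ℂ) (ψ x) * ψ' x).im)
        + -2 * pbar * ((starRingEnd ℂ) (ψ x) * ψ' x).im := fun x => by
    rw [Complex.norm_sq_add_mul_expand]
    ring
  have s1 := k0.fun_add (nyy.const_mul (a ^ 2 + b ^ 2))
  have s2 := s1.fun_add (ny.const_mul (-2 * b * pbar))
  have s3 := s2.fun_add (n0.const_mul (pbar ^ 2))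
  have s4 := s3.fun_add (ry.const_mul (2 * a))
  have s5 := s4.fun_add (iy.const_mul (2 * b))
  simp_rw [hexp] at hpos
  rw [integral_add s5 (i0.const_mul _), integral_add s4 (iy.const_mul _),
    integral_add s3 (ry.const_mul _), integral_add s2 (n0.const_mul _),
    integral_add s1 (ny.const_mul _), integral_add k0 (nyy.const_mul _)] at hpos
  simp only [integral_const_mul, Iny, Iiy, Iry, hnorm, ← hp, ← hVq] at hpos
  linarith
end

section
/- Let a, b, c, d be real numbers with a*d - b*c = 1, and define the 3×3 real matrix Λ with rows (½(a²+b²+c²+d²), ½(a²-b²+c²-d²), a*b+c*d), (½(a²+b²-c²-d²), ½(a²-b²-c²+d²), a*b-c*d), (a*c+b*d, a*c-b*d, a*d+b*c), and let g = diag(1, -1, -1). Then: (i) Λ * g * Λᵀ = g; (ii) det Λ = 1; and (iii) the (0,0) entry of Λ satisfies Λ 0 0 ≥ 1. -/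
open Matrix

/-- Eq. (5.11) of the paper: the explicit map `S = [[a,b],[c,d]] ∈ Sp(2,R) ↦ Λ(S)`
lands in the proper orthochronous Lorentz group SO(2,1): `Λ g Λᵀ = g` for
`g = diag(1,-1,-1)`, `det Λ = 1`, and `Λ 0 0 ≥ 1`. -/
theorem sp2r_to_so21 (a b c d : ℝ) (h : a * d - b * c = 1) :
    let Λ : Matrix (Fin 3) (Fin 3) ℝ :=
      !![(a ^ 2 + b ^ 2 + c ^ 2 + d ^ 2) / 2, (a ^ 2 - b ^ 2 + c ^ 2 - d ^ 2) / 2, a * b + c * d;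
         (a ^ 2 + b ^ 2 - c ^ 2 - d ^ 2) / 2, (a ^ 2 - b ^ 2 - c ^ 2 + d ^ 2) / 2, a * b - c * d;
         a * c + b * d, a * c - b * d, a * d + b * c]
    let g : Matrix (Fin 3) (Fin 3) ℝ := !![1, 0, 0; 0, -1, 0; 0, 0, -1]
    Λ * g * Λᵀ = g ∧ Λ.det = 1 ∧ 1 ≤ Λ 0 0 := by
  intro Λ g
  have h₂ : (a * d - b * c) ^ 2 = 1 := by rw [h, one_pow]
  have h₃ : (a * d - b * c) ^ 3 = 1 := by rw [h, one_pow]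
  refine ⟨?_, ?_, ?_⟩
  · ext i j
    fin_cases i <;> fin_cases j <;>
      simp [Λ, g, Matrix.mul_apply, Fin.sum_univ_three] <;>
      first
      | ring1
      | linear_combination h₂
      | linear_combination -h₂
  · simp only [Λ, Matrix.det_fin_three, Matrix.of_apply, Matrix.cons_val]
    linear_combination h₃
  · change 1 ≤ (a ^ 2 + b ^ 2 + c ^ 2 + d ^ 2) / 2
    nlinarith [sq_nonneg (a - d), sq_nonneg (b + c)]
end

section
/- Fix a natural number n and (in units with ℏ = 1) define the 3×3 complex matrix M_n = ((n² + n + 1)/2) • diag(0, 1, 1) + (Complex.I * (n + 1/2)) • [[0,0,0],[0,0,1],[0,-1,0]]. Then the characteristic polynomial of M_n equals X * (X - (n+1)*(n+2)/2) * (X - n*(n-1)/2); in particular M_n is positive semidefinite, with eigenvalues 0, (n+1)(n+2)/2, and n(n-1)/2. -/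
open Matrix ComplexOrder Polynomial

/-- The Hermitian matrix with nonnegative weights `p`, `q` along the orthogonal vectors
`(0, 1, -i)` and `(0, 1, i)` is positive semidefinite. -/
theorem posSemidef_smul_vecMulVec_add {p q : ℂ} (hp : 0 ≤ p) (hq : 0 ≤ q) :
    (!![0, 0, 0; 0, p + q, Complex.I * (p - q); 0, -(Complex.I * (p - q)), p + q] :
      Matrix (Fin 3) (Fin 3) ℂ).PosSemidef := by
  have h := ((posSemidef_vecMulVec_self_star (![0, 1, -Complex.I] : Fin 3 → ℂ)).smul hp).add
    ((posSemidef_vecMulVec_self_star (![0, 1, Complex.I] : Fin 3 → ℂ)).smul hq)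
  convert h using 1
  ext i j
  fin_cases i <;> fin_cases j <;>
    simp [-cons_vecMulVec, -vecMulVec_cons, Matrix.add_apply, Matrix.smul_apply, vecMulVec_apply] <;> ring

/-- Eqs. (5.36)–(5.37) of the paper: in the Fock state `|n⟩` (with ℏ = 1) the
fourth-order uncertainty matrix `M_n = V^(eff) + (i/2) ω^(eff)` has characteristic
polynomial `X (X - (n+1)(n+2)/2) (X - n(n-1)/2)`; in particular it is positive
semidefinite with eigenvalues `0`, `(n+1)(n+2)/2` and `n(n-1)/2`, so the Fock
states respect (indeed saturate) the fourth-order uncertainty relation. -/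
theorem fock_state_fourth_order (n : ℕ) :
    let M : Matrix (Fin 3) (Fin 3) ℂ :=
      ((((n : ℂ) ^ 2 + (n : ℂ) + 1) / 2) •
          Matrix.diagonal ![0, 1, 1]) +
        ((Complex.I * ((n : ℂ) + 1 / 2)) •
          (!![0, 0, 0; 0, 0, 1; 0, -1, 0] : Matrix (Fin 3) (Fin 3) ℂ))
    M.charpoly =
        X * (X - C (((n : ℂ) + 1) * ((n : ℂ) + 2) / 2)) *
          (X - C ((n : ℂ) * ((n : ℂ) - 1) / 2)) ∧
      M.PosSemidef := by
  intro M
  have hM : M = !![0, 0, 0;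
      0, ((n : ℂ) ^ 2 + n + 1) / 2, Complex.I * (n + 1 / 2);
      0, -(Complex.I * (n + 1 / 2)), ((n : ℂ) ^ 2 + n + 1) / 2] := by
    ext i j
    fin_cases i <;> fin_cases j <;> simp [M]
  constructor
  · rw [hM, charpoly, det_fin_three]
    apply Polynomial.funext
    intro x
    simp
    linear_combination x * ((n : ℂ) + 1 / 2) ^ 2 * Complex.I_sq
  · have hp : (0 : ℂ) ≤ ((n : ℂ) + 1) * (n + 2) / 4 := by positivity
    have hq : (0 : ℂ) ≤ (n : ℂ) * (n - 1) / 4 := by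
      have h : (0 : ℝ) ≤ (n : ℝ) * (n - 1) / 4 := by
        rcases n with _ | k
        · simp
        · push_cast
          rw [add_sub_cancel_right]
          positivity
      simpa using Complex.zero_le_real.mpr h
    rw [hM]
    have hsum : ((n : ℂ) ^ 2 + n + 1) / 2 = (n + 1) * (n + 2) / 4 + n * (n - 1) / 4 := by ring
    have hdiff : (n : ℂ) + 1 / 2 = (n + 1) * (n + 2) / 4 - n * (n - 1) / 4 := by ring
    rw [hsum, hdiff]
    exact posSemidef_smul_vecMulVec_add hp hq
end
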